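/- Let f : ℝ^n → ℂ be a Schwartz function and let Φ : ℝ^n → ℝ^n be a diffeomorphism with a simple fixed point at y₀ (i.e., Φ(y₀) = y₀ and det(I - dΦ(y₀)) ≠ 0), and suppose Φ has no other fixed points on the support of a bump function α ∈ C_c^∞(ℝ^n) with α ≡ 1 near y₀. Then lim_{ε→0} ∫∫ e^{i⟨y - Φ(y), ξ⟩} α(y) χ(εξ) dy d̄ξ = α(y₀)/|det(I - dΦ(y₀))|, where χ ∈ C_c^∞(ℝ^n) with χ(0) = 1 and d̄ξ = (2π)^{-n} dξ. -/

import Mathlib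

open MeasureTheory Filter

open scoped SchwartzMap FourierTransform

/-- The inverse Fourier transform of a smooth compactly supported function on `Fin n → ℝ`, as a
Schwartz function, together with its total integral. -/
lemma exists_schwartzMap_eq_fourierInv {n : ℕ} {χ : (Fin n → ℝ) → ℝ}
    (hχ : ContDiff ℝ (⊤ : ℕ∞) χ) (hχc : HasCompactSupport χ) :
    ∃ F : 𝓢(Fin n → ℝ, ℂ),
      (∀ w, F w = ∫ ξ : Fin n → ℝ,
        Complex.exp (Complex.I * ((2 * Real.pi * ∑ i, w i * ξ i : ℝ) : ℂ)) * (χ ξ : ℂ)) ∧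
      ∫ w, F w = χ 0 := by
  let e : EuclideanSpace ℝ (Fin n) ≃L[ℝ] (Fin n → ℝ) := EuclideanSpace.equiv (Fin n) ℝ
  have hsm : ContDiff ℝ (⊤ : ℕ∞) (fun ξ : EuclideanSpace ℝ (Fin n) => (χ (e ξ) : ℂ)) :=
    Complex.ofRealCLM.contDiff.comp (hχ.comp e.contDiff)
  have hcs : HasCompactSupport (fun ξ : EuclideanSpace ℝ (Fin n) => (χ (e ξ) : ℂ)) :=
    (hχc.comp_homeomorph e.toHomeomorph).comp_left (g := fun x : ℝ => (x : ℂ)) (by simp)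
  let f : 𝓢(EuclideanSpace ℝ (Fin n), ℂ) := hcs.toSchwartzMap hsm
  have hf : ∀ ξ, f ξ = (χ (e ξ) : ℂ) := fun ξ => rfl
  refine ⟨SchwartzMap.compCLMOfContinuousLinearEquiv ℂ e.symm (𝓕⁻ f), fun w => ?_, ?_⟩
  · rw [SchwartzMap.compCLMOfContinuousLinearEquiv_apply, Function.comp_apply,
      SchwartzMap.fourierInv_coe, Real.fourierInv_eq',
      ← (PiLp.volume_preserving_toLp (Fin n)).integral_comp
        (MeasurableEquiv.toLp 2 (Fin n → ℝ)).measurableEmbedding]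
    refine integral_congr_ae (Eventually.of_forall fun ξ => ?_)
    simp only [hf, smul_eq_mul, PiLp.inner_apply]
    rw [mul_comm Complex.I]
    rfl
  · have h0 : (𝓕 (𝓕⁻ f)) 0 = f 0 := by rw [FourierTransform.fourier_fourierInv_eq]
    rw [SchwartzMap.fourier_coe, Real.fourier_eq'] at h0
    have h1 : ∫ v, (𝓕⁻ f) v = (χ 0 : ℂ) := by simpa [hf] using h0
    rw [← h1, ← (PiLp.volume_preserving_toLp (Fin n)).integral_comp
        (MeasurableEquiv.toLp 2 (Fin n → ℝ)).measurableEmbedding]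
    rfl

/-- A function with an isolated zero on a compact set, at which its derivative is injective,
controls the distance to that zero. -/
lemma IsCompact.exists_norm_sub_le_mul_norm {E F : Type*} [NormedAddCommGroup E] [NormedSpace ℝ E]
    [NormedAddCommGroup F] [NormedSpace ℝ F] {s : Set E} (hs : IsCompact s) {g : E → F}
    (hg : Continuous g) {x₀ : E} {A : E ≃L[ℝ] F} (hA : HasFDerivAt g (A : E →L[ℝ] F) x₀)
    (hx₀ : g x₀ = 0) (hzero : ∀ x ∈ s, g x = 0 → x = x₀) :
    ∃ C : ℝ, 1 ≤ C ∧ ∀ x ∈ s, ‖x - x₀‖ ≤ C * ‖g x‖ := by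
  refine hs.induction_on ⟨1, le_rfl, by simp⟩ ?_ ?_ ?_
  · rintro s t hst ⟨C, hC, h⟩
    exact ⟨C, hC, fun x hx => h x (hst hx)⟩
  · rintro s t ⟨C, hC, h⟩ ⟨D, hD, h'⟩
    refine ⟨max C D, hC.trans (le_max_left _ _), ?_⟩
    rintro x (hx | hx)
    · exact (h x hx).trans (by gcongr; exact le_max_left _ _)
    · exact (h' x hx).trans (by gcongr; exact le_max_right _ _)
  · intro x hx
    have hO : (fun y => y - x₀) =O[nhds x] g := by
      rcases eq_or_ne x x₀ with rfl | hne
      · have h := hA.isTheta_sub A.toHomeomorph.isInducing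
        simpa [hx₀] using h.isBigO_symm
      · have hgx : g x ≠ 0 := fun h => hne (hzero x hx h)
        exact ((continuous_id.sub continuous_const).continuousAt.isBigO_one ℝ).trans
          ((Asymptotics.isBigO_const_left_iff_pos_le_norm one_ne_zero).2
            ⟨‖g x‖ / 2, by positivity, (hg.norm.continuousAt.eventually_const_le
              (half_lt_self (norm_pos_iff.2 hgx)))⟩)
    obtain ⟨C, hC⟩ := hO.bound
    refine ⟨_, mem_nhdsWithin_of_mem_nhds hC, max C 1, le_max_right _ _, fun y hy => ?_⟩
    exact (show ‖y - x₀‖ ≤ C * ‖g y‖ from hy).trans (by gcongr; exact le_max_left _ _)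

/-- A Schwartz function decays faster than any power of `1 + ‖x‖`. -/
lemma SchwartzMap.exists_one_add_norm_pow_mul_le {E F : Type*} [NormedAddCommGroup E]
    [NormedSpace ℝ E] [NormedAddCommGroup F] [NormedSpace ℝ F] (f : 𝓢(E, F)) (k : ℕ) :
    ∃ C : ℝ, 0 ≤ C ∧ ∀ x, (1 + ‖x‖) ^ k * ‖f x‖ ≤ C := by
  have h : ∀ x, (1 + ‖x‖) ^ k * ‖f x‖ ≤ _ := fun x => by
    simpa using SchwartzMap.one_add_le_sup_seminorm_apply (𝕜 := ℝ) (m := (k, 0)) le_rfl le_rfl f x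
  exact ⟨_, le_trans (by positivity) (h 0), h⟩

/-- The rescaled integrals `∫ α (y₀ + R z) F (R⁻¹ g (y₀ + R z)) dz` converge, as `R → 0⁺`, to the
integral of `F` along the linearization of `g` at its zero `y₀`. -/
lemma tendsto_integral_rescaled {n : ℕ} {g : (Fin n → ℝ) → (Fin n → ℝ)} (hg : Continuous g)
    {y₀ : Fin n → ℝ} {A : (Fin n → ℝ) ≃L[ℝ] (Fin n → ℝ)}
    (hA : HasFDerivAt g (A : (Fin n → ℝ) →L[ℝ] (Fin n → ℝ)) y₀) (hy₀ : g y₀ = 0)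
    {α : (Fin n → ℝ) → ℝ} (hα : Continuous α) (hαc : HasCompactSupport α)
    (hzero : ∀ y ∈ tsupport α, g y = 0 → y = y₀) (F : 𝓢(Fin n → ℝ, ℂ)) :
    Tendsto (fun R : ℝ => ∫ z, (α (y₀ + R • z) : ℂ) * F (R⁻¹ • g (y₀ + R • z)))
      (nhdsWithin 0 (Set.Ioi (0:ℝ))) (nhds (∫ z, (α y₀ : ℂ) * F (A z))) := by
  obtain ⟨C, hC, hCg⟩ := IsCompact.exists_norm_sub_le_mul_norm hαc hg hA hy₀ hzero
  obtain ⟨D, hD, hDF⟩ := F.exists_one_add_norm_pow_mul_le (n + 1)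
  obtain ⟨M, hM⟩ := hα.bounded_above_of_compact_support hαc
  have hM0 : 0 ≤ M := (norm_nonneg _).trans (hM 0)
  refine tendsto_integral_filter_of_dominated_convergence
    (fun z => M * C ^ (n + 1) * D * (1 + ‖z‖) ^ (-((n : ℝ) + 1))) ?_ ?_ ?_ ?_
  · refine Eventually.of_forall fun R => Continuous.aestronglyMeasurable ?_
    have := F.continuous
    fun_prop
  · filter_upwards [self_mem_nhdsWithin] with R hR
    have hR : 0 < R := hR
    refine Eventually.of_forall fun z => ?_
    have hpos : (0 : ℝ) < (1 + ‖z‖) ^ (n + 1) := by positivity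
    rw [Real.rpow_neg (by positivity), ← Nat.cast_add_one, Real.rpow_natCast, ← div_eq_mul_inv,
      le_div_iff₀ hpos]
    by_cases hz : y₀ + R • z ∈ tsupport α
    · have h1 := hCg _ hz
      rw [add_sub_cancel_left, norm_smul, Real.norm_of_nonneg hR.le] at h1
      set w := g (y₀ + R • z)
      have h2 : ‖z‖ ≤ C * ‖R⁻¹ • w‖ := by
        rw [norm_smul, norm_inv, Real.norm_of_nonneg hR.le]
        calc ‖z‖ = R⁻¹ * (R * ‖z‖) := by field_simp
          _ ≤ R⁻¹ * (C * ‖w‖) := by gcongr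
          _ = C * (R⁻¹ * ‖w‖) := by ring
      have h3 : 1 + ‖z‖ ≤ C * (1 + ‖R⁻¹ • w‖) := by linarith
      have h4 := hM (y₀ + R • z)
      have h5 := hDF (R⁻¹ • w)
      rw [norm_mul, Complex.norm_real]
      calc ‖α (y₀ + R • z)‖ * ‖F (R⁻¹ • w)‖ * (1 + ‖z‖) ^ (n + 1)
          ≤ M * ‖F (R⁻¹ • w)‖ * (C * (1 + ‖R⁻¹ • w‖)) ^ (n + 1) := by gcongr
        _ = M * C ^ (n + 1) * ((1 + ‖R⁻¹ • w‖) ^ (n + 1) * ‖F (R⁻¹ • w)‖) := by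
          rw [mul_pow]; ring
        _ ≤ M * C ^ (n + 1) * D := by gcongr
    · rw [image_eq_zero_of_notMem_tsupport hz]
      simp only [Complex.ofReal_zero, zero_mul, norm_zero]
      positivity
  · exact (integrable_one_add_norm (by simp)).const_mul _
  · refine Eventually.of_forall fun z => Tendsto.mul ?_ ?_
    · have : Continuous fun R : ℝ => (α (y₀ + R • z) : ℂ) := by fun_prop
      simpa using (this.tendsto 0).mono_left nhdsWithin_le_nhds
    · have h := (hA.hasLineDerivAt z).tendsto_slope_zero_right
      simp only [hy₀, sub_zero] at h
      exact (F.continuous.tendsto _).comp h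

/-- Change of variables for an invertible linear map. -/
lemma integral_comp_continuousLinearEquiv {n : ℕ} (A : (Fin n → ℝ) ≃L[ℝ] (Fin n → ℝ))
    (F : (Fin n → ℝ) → ℂ) :
    ∫ z, F (A z) =
      ((|LinearMap.det (A : (Fin n → ℝ) →ₗ[ℝ] (Fin n → ℝ))| : ℝ) : ℂ)⁻¹ * ∫ z, F z := by
  have hdet : LinearMap.det (A : (Fin n → ℝ) →ₗ[ℝ] (Fin n → ℝ)) ≠ 0 :=
    (LinearEquiv.isUnit_det' A.toLinearEquiv).ne_zero
  have h := Measure.map_linearMap_addHaar_eq_smul_addHaar (volume : Measure (Fin n → ℝ)) hdet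
  have h2 := A.toHomeomorph.measurableEmbedding.integral_map (μ := volume) F
  change ∫ z, F z ∂(Measure.map A volume) = ∫ z, F (A z) at h2
  change Measure.map A volume = _ at h
  rw [← h2, h, integral_smul_measure, ENNReal.toReal_ofReal (abs_nonneg _), abs_inv,
    Complex.real_smul, Complex.ofReal_inv]

/-- Fubini and rescaling: the regularized oscillatory integral as an absolutely convergent
rescaled integral against the Schwartz function `F`. -/
lemma oscillatory_integral_eq_rescaled {n : ℕ} {g : (Fin n → ℝ) → (Fin n → ℝ)} (hg : Continuous g)
    (y₀ : Fin n → ℝ) {α χ : (Fin n → ℝ) → ℝ} (hα : Continuous α) (hαc : HasCompactSupport α)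
    (hχ : Continuous χ) (hχc : HasCompactSupport χ) (F : (Fin n → ℝ) → ℂ)
    (hF : ∀ w, F w = ∫ ξ : Fin n → ℝ,
      Complex.exp (Complex.I * ((2 * Real.pi * ∑ i, w i * ξ i : ℝ) : ℂ)) * (χ ξ : ℂ))
    {ε : ℝ} (hε : 0 < ε) :
    ((2 * Real.pi) ^ n : ℝ)⁻¹ •
      ∫ ξ : Fin n → ℝ,
        (∫ y : Fin n → ℝ,
          Complex.exp (Complex.I * ((∑ i, g y i * ξ i : ℝ) : ℂ)) * (α y : ℂ))
        * ((χ (ε • ξ) : ℝ) : ℂ) =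
    ∫ z, (α (y₀ + (2 * Real.pi * ε) • z) : ℂ) *
      F ((2 * Real.pi * ε)⁻¹ • g (y₀ + (2 * Real.pi * ε) • z)) := by
  have hinner : ∀ w : Fin n → ℝ,
      ∫ ξ : Fin n → ℝ, Complex.exp (Complex.I * ((∑ i, w i * ξ i : ℝ) : ℂ)) * (χ (ε • ξ) : ℂ) =
        (ε ^ n)⁻¹ • F ((2 * Real.pi * ε)⁻¹ • w) := by
    intro w
    have h := Measure.integral_comp_smul_of_nonneg (volume : Measure (Fin n → ℝ))
      (fun ξ : Fin n → ℝ => Complex.exp (Complex.I * ((2 * Real.pi *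
        ∑ i, ((2 * Real.pi * ε)⁻¹ • w) i * ξ i : ℝ) : ℂ)) * (χ ξ : ℂ)) ε (hR := hε.le)
    rw [← hF, Module.finrank_fin_fun] at h
    rw [← h]
    congr 1 with ξ
    congr 5
    rw [Finset.mul_sum]
    refine Finset.sum_congr rfl fun i _ => ?_
    simp only [Pi.smul_apply, smul_eq_mul]
    field_simp
  have hint : Integrable (fun p : (Fin n → ℝ) × (Fin n → ℝ) =>
      Complex.exp (Complex.I * ((∑ i, g p.2 i * p.1 i : ℝ) : ℂ)) *
        ((χ (ε • p.1) : ℂ) * (α p.2 : ℂ))) (volume.prod volume) := by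
    have hχi : Integrable (fun ξ : Fin n → ℝ => (χ (ε • ξ) : ℂ)) :=
      ((hχ.integrable_of_hasCompactSupport hχc).comp_smul hε.ne').ofReal
    have hαi : Integrable (fun y : Fin n → ℝ => (α y : ℂ)) :=
      (hα.integrable_of_hasCompactSupport hαc).ofReal
    refine (hχi.mul_prod hαi).bdd_mul (c := 1) ?_ (Eventually.of_forall fun p => ?_)
    · exact Continuous.aestronglyMeasurable (by fun_prop)
    · rw [mul_comm, Complex.norm_exp_ofReal_mul_I]
  have hfub : ∫ ξ : Fin n → ℝ,
        (∫ y : Fin n → ℝ,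
          Complex.exp (Complex.I * ((∑ i, g y i * ξ i : ℝ) : ℂ)) * (α y : ℂ))
        * ((χ (ε • ξ) : ℝ) : ℂ) =
      (ε ^ n)⁻¹ • ∫ y, (α y : ℂ) * F ((2 * Real.pi * ε)⁻¹ • g y) := by
    rw [← integral_smul]
    calc _ = ∫ ξ : Fin n → ℝ, ∫ y : Fin n → ℝ,
          Complex.exp (Complex.I * ((∑ i, g y i * ξ i : ℝ) : ℂ)) *
            ((χ (ε • ξ) : ℂ) * (α y : ℂ)) := by
          congr 1 with ξ
          rw [← integral_mul_const]
          congr 1 with y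
          ring
      _ = ∫ y : Fin n → ℝ, ∫ ξ : Fin n → ℝ,
          Complex.exp (Complex.I * ((∑ i, g y i * ξ i : ℝ) : ℂ)) *
            ((χ (ε • ξ) : ℂ) * (α y : ℂ)) := integral_integral_swap hint
      _ = _ := by
          congr 1 with y
          rw [mul_comm (α y : ℂ), ← smul_mul_assoc, ← hinner, ← integral_mul_const]
          congr 1 with ξ
          ring
  have hR : 0 < 2 * Real.pi * ε := by positivity
  have hscale := Measure.integral_comp_smul_of_nonneg (volume : Measure (Fin n → ℝ))
    (fun y => (α (y₀ + y) : ℂ) * F ((2 * Real.pi * ε)⁻¹ • g (y₀ + y))) (2 * Real.pi * ε)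
    (hR := hR.le)
  rw [hfub, hscale, Module.finrank_fin_fun,
    integral_add_left_eq_self (fun y => (α y : ℂ) * F ((2 * Real.pi * ε)⁻¹ • g y)), smul_smul,
    mul_pow (2 * Real.pi), mul_inv ((2 * Real.pi) ^ n)]

/-- Regularized oscillatory-integral computation of a simple fixed point
contribution. Let `Φ` be a diffeomorphism of `ℝ^n` with simple fixed point `y₀`
(`Φ(y₀) = y₀`, `det(I - dΦ(y₀)) ≠ 0`), let `α ∈ C_c^∞` be `≡ 1` near `y₀` with no other
fixed point of `Φ` in its support, and `χ ∈ C_c^∞` with `χ(0) = 1`. Then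
`lim_{ε→0⁺} ∫∫ e^{i⟨y-Φ(y),ξ⟩} α(y) χ(εξ) dy d̄ξ = α(y₀)/|det(I - dΦ(y₀))|`. -/
theorem stmt18 {n : ℕ} (Φ : (Fin n → ℝ) → (Fin n → ℝ)) (Ψ : (Fin n → ℝ) → (Fin n → ℝ))
    (hΦ : ContDiff ℝ (⊤ : ℕ∞) Φ) (hΨ : ContDiff ℝ (⊤ : ℕ∞) Ψ)
    (hinv : Function.LeftInverse Ψ Φ ∧ Function.RightInverse Ψ Φ)
    (y₀ : Fin n → ℝ) (hfix : Φ y₀ = y₀)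
    (hsimple : LinearMap.det
      (((ContinuousLinearMap.id ℝ (Fin n → ℝ)) - fderiv ℝ Φ y₀ :
        (Fin n → ℝ) →L[ℝ] (Fin n → ℝ)) : (Fin n → ℝ) →ₗ[ℝ] (Fin n → ℝ)) ≠ 0)
    (α : (Fin n → ℝ) → ℝ) (hα : ContDiff ℝ (⊤ : ℕ∞) α) (hαc : HasCompactSupport α)
    (hα1 : ∀ᶠ y in nhds y₀, α y = 1)
    (honly : ∀ y ∈ tsupport α, Φ y = y → y = y₀)
    (χ : (Fin n → ℝ) → ℝ) (hχ : ContDiff ℝ (⊤ : ℕ∞) χ) (hχc : HasCompactSupport χ)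
    (hχ0 : χ 0 = 1) :
    Tendsto (fun ε : ℝ =>
        ((2 * Real.pi) ^ n : ℝ)⁻¹ •
          ∫ ξ : Fin n → ℝ,
            (∫ y : Fin n → ℝ,
              Complex.exp (Complex.I * ((∑ i, (y i - Φ y i) * ξ i : ℝ) : ℂ)) * (α y : ℂ))
            * ((χ (ε • ξ) : ℝ) : ℂ))
      (nhdsWithin 0 (Set.Ioi (0:ℝ)))
      (nhds (((α y₀ : ℝ) : ℂ) /
        ((|LinearMap.det
          (((ContinuousLinearMap.id ℝ (Fin n → ℝ)) - fderiv ℝ Φ y₀ :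
            (Fin n → ℝ) →L[ℝ] (Fin n → ℝ)) : (Fin n → ℝ) →ₗ[ℝ] (Fin n → ℝ))| : ℝ) : ℂ))) := by
  obtain ⟨F, hF, hFint⟩ := exists_schwartzMap_eq_fourierInv hχ hχc
  have hd : HasFDerivAt (fun y => y - Φ y)
      (ContinuousLinearMap.id ℝ (Fin n → ℝ) - fderiv ℝ Φ y₀) y₀ :=
    (hasFDerivAt_id y₀).sub (hΦ.differentiable (by simp) y₀).hasFDerivAt
  set B : (Fin n → ℝ) →L[ℝ] (Fin n → ℝ) :=
    ContinuousLinearMap.id ℝ (Fin n → ℝ) - fderiv ℝ Φ y₀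
  let A : (Fin n → ℝ) ≃L[ℝ] (Fin n → ℝ) :=
    (LinearEquiv.ofIsUnitDet (f := (B : (Fin n → ℝ) →ₗ[ℝ] (Fin n → ℝ)))
      (v := Pi.basisFun ℝ (Fin n)) (v' := Pi.basisFun ℝ (Fin n))
      (by rw [LinearMap.det_toMatrix]; exact hsimple.isUnit)).toContinuousLinearEquiv
  have hAB : (A : (Fin n → ℝ) →L[ℝ] (Fin n → ℝ)) = B := by ext; rfl
  have hg : Continuous fun y => y - Φ y := continuous_id.sub hΦ.continuous
  have hlim := tendsto_integral_rescaled hg (hAB ▸ hd) (by simp [hfix]) hα.continuous hαc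
    (fun y hy h => honly y hy (sub_eq_zero.1 h).symm) F
  have hval : ∫ z, (α y₀ : ℂ) * F (A z) =
      (α y₀ : ℂ) / ((|LinearMap.det (B : (Fin n → ℝ) →ₗ[ℝ] (Fin n → ℝ))| : ℝ) : ℂ) := by
    rw [integral_const_mul, integral_comp_continuousLinearEquiv, hFint, hχ0, Complex.ofReal_one,
      mul_one, div_eq_mul_inv, ← hAB]
    rfl
  rw [hval] at hlim
  have hscale : Tendsto (fun ε : ℝ => 2 * Real.pi * ε) (nhdsWithin 0 (Set.Ioi 0))
      (nhdsWithin 0 (Set.Ioi 0)) := by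
    refine tendsto_nhdsWithin_iff.2 ⟨?_, ?_⟩
    · have : Continuous fun ε : ℝ => 2 * Real.pi * ε := by fun_prop
      simpa using (this.tendsto 0).mono_left nhdsWithin_le_nhds
    · filter_upwards [self_mem_nhdsWithin] with ε hε
      exact mul_pos Real.two_pi_pos hε
  refine (hlim.comp hscale).congr' ?_
  filter_upwards [self_mem_nhdsWithin] with ε hε
  exact (oscillatory_integral_eq_rescaled hg y₀ hα.continuous hαc hχ.continuous hχc F hF hε).symm
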